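/- arXiv:2402.06618 — 2 statements merged into one kernel-verified Lean document; each statement's English description precedes it below -/
import Mathlib

section
/- The pointwise limit h(x) := inf_{n≥0} h_n(x) of the canonical iterates belongs to E and is a fixed point of T, i.e. Th = h. -/
open Set MeasureTheory Polynomial

noncomputable section

/-- The class `E` of antitone functions `g : [0,1] → [0,1]` with `g 0 = 1` and
positive integral (functions are modelled as total functions `ℝ → ℝ`,
constrained on `[0,1]`). -/
def E : Set (ℝ → ℝ) :=
  {g | AntitoneOn g (Icc 0 1) ∧ MapsTo g (Icc 0 1) (Icc 0 1) ∧ g 0 = 1 ∧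
    0 < ∫ x in (0:ℝ)..1, g x}

/-- The pseudo-inverse `g*` of `g`, given by `g* y = sup {x ∈ [0,1] | g x ≥ y}`. -/
def pseudoInv (g : ℝ → ℝ) : ℝ → ℝ := fun y => sSup {x | x ∈ Icc (0:ℝ) 1 ∧ y ≤ g x}

/-- The stribolic operator `T`, `(T g) x = (∫_x^1 g*) / (∫_0^1 g)`. -/
def T (g : ℝ → ℝ) : ℝ → ℝ := fun x =>
  (∫ t in x..(1:ℝ), pseudoInv g t) / (∫ t in (0:ℝ)..1, g t)

/-- The canonical stribolic iterates: `h 0 = 1` and `h (n+1) = T (h n)`. -/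
def h : ℕ → ℝ → ℝ
  | 0 => fun _ => 1
  | n + 1 => T (h n)

/-- `κ n = ∫_0^1 h n`. -/
def κ (n : ℕ) : ℝ := ∫ t in (0:ℝ)..1, h n t

/-- The compositions `q n = h n ∘ ⋯ ∘ h 1`, with `q 0 = id`. -/
def q : ℕ → ℝ → ℝ
  | 0 => fun x => x
  | n + 1 => h (n + 1) ∘ q n

/-- `q (n-1)`, with the convention that for `n = 0` (i.e. "`q (-1)`") it is the
constant function `1` (the only convention making the `n = 0` cases hold). -/
def qprev : ℕ → ℝ → ℝ
  | 0 => fun _ => 1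
  | n + 1 => q n

/-- `Q n x = ∫_0^x (q n)' (t) * q (n-1) (t) dt`. -/
def Q (n : ℕ) (x : ℝ) : ℝ := ∫ t in (0:ℝ)..x, deriv (q n) t * qprev n t

lemma bddAbove_superlevel (f : ℝ → ℝ) (y : ℝ) :
    BddAbove {x | x ∈ Icc (0:ℝ) 1 ∧ y ≤ f x} :=
  ⟨1, fun _ hx => hx.1.2⟩

lemma pseudoInv_nonneg (f : ℝ → ℝ) (y : ℝ) : 0 ≤ pseudoInv f y :=
  Real.sSup_nonneg fun _ hx => hx.1.1

lemma pseudoInv_le_one (f : ℝ → ℝ) (y : ℝ) : pseudoInv f y ≤ 1 :=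
  Real.sSup_le (fun _ hx => hx.1.2) zero_le_one

lemma le_pseudoInv {f : ℝ → ℝ} {x y : ℝ} (hx : x ∈ Icc (0:ℝ) 1) (hy : y ≤ f x) :
    x ≤ pseudoInv f y :=
  le_csSup (bddAbove_superlevel f y) ⟨hx, hy⟩

lemma exists_of_lt_pseudoInv {f : ℝ → ℝ} {x y : ℝ} (hx : 0 ≤ x) (hxy : x < pseudoInv f y) :
    ∃ u ∈ Icc (0:ℝ) 1, x < u ∧ y ≤ f u := by
  have hne : {x | x ∈ Icc (0:ℝ) 1 ∧ y ≤ f x}.Nonempty := by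
    by_contra hempty
    rw [not_nonempty_iff_eq_empty] at hempty
    rw [pseudoInv, hempty, Real.sSup_empty] at hxy
    linarith
  obtain ⟨u, hu, hxu⟩ := exists_lt_of_lt_csSup hne hxy
  exact ⟨u, hu.1, hxu, hu.2⟩

lemma le_of_lt_pseudoInv {f : ℝ → ℝ} (hf : AntitoneOn f (Icc 0 1)) {x y : ℝ} (hx : 0 ≤ x)
    (hxy : x < pseudoInv f y) : y ≤ f x := by
  obtain ⟨u, hu, hxu, hyu⟩ := exists_of_lt_pseudoInv hx hxy
  exact hyu.trans (hf ⟨hx, hxu.le.trans hu.2⟩ hu hxu.le)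

lemma pseudoInv_mono {f g : ℝ → ℝ} (hfg : ∀ x ∈ Icc (0:ℝ) 1, f x ≤ g x) (y : ℝ) :
    pseudoInv f y ≤ pseudoInv g y :=
  Real.sSup_le (fun _ hx => le_pseudoInv hx.1 (hx.2.trans (hfg _ hx.1))) (pseudoInv_nonneg g y)

lemma pseudoInv_antitone (f : ℝ → ℝ) : Antitone (pseudoInv f) := fun a _ hab =>
  Real.sSup_le (fun _ hx => le_pseudoInv hx.1 (hab.trans hx.2)) (pseudoInv_nonneg f a)

lemma intervalIntegrable_pseudoInv (f : ℝ → ℝ) (a b : ℝ) :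
    IntervalIntegrable (pseudoInv f) volume a b :=
  (pseudoInv_antitone f).intervalIntegrable

lemma pseudoInv_congr {f g : ℝ → ℝ} (hfg : ∀ x ∈ Icc (0:ℝ) 1, f x = g x) :
    pseudoInv f = pseudoInv g :=
  funext fun y => le_antisymm (pseudoInv_mono (fun x hx => (hfg x hx).le) y)
    (pseudoInv_mono (fun x hx => (hfg x hx).ge) y)

lemma T_congr {f g : ℝ → ℝ} (hfg : ∀ x ∈ Icc (0:ℝ) 1, f x = g x) : T f = T g := by
  have hint : ∫ t in (0:ℝ)..1, f t = ∫ t in (0:ℝ)..1, g t :=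
    intervalIntegral.integral_congr fun x hx => hfg x (by rwa [uIcc_of_le zero_le_one] at hx)
  funext x
  simp only [T, pseudoInv_congr hfg, hint]

/-- Functions on `[0, ∞)` that decrease from `1` at `0`, vanish beyond `1`, and lie above the line
of slope `-K` through `(0, 1)`. -/
structure IsProfile (K : ℝ) (f : ℝ → ℝ) : Prop where
  antitone : AntitoneOn f (Ici 0)
  nonneg : ∀ x, 0 ≤ x → 0 ≤ f x
  eq_zero : ∀ x, 1 < x → f x = 0
  map_zero : f 0 = 1
  one_le : 1 ≤ K
  lower : ∀ x ∈ Icc (0:ℝ) 1, 1 - K * x ≤ f x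

namespace IsProfile

variable {K L : ℝ} {f g : ℝ → ℝ}

lemma antitoneOn_Icc (hf : IsProfile K f) : AntitoneOn f (Icc 0 1) :=
  hf.antitone.mono fun _ hx => hx.1

lemma le_one (hf : IsProfile K f) {x : ℝ} (hx : 0 ≤ x) : f x ≤ 1 :=
  hf.map_zero ▸ hf.antitone (mem_Ici.2 le_rfl) hx hx

lemma intervalIntegrable (hf : IsProfile K f) : IntervalIntegrable f volume 0 1 :=
  AntitoneOn.intervalIntegrable (by rw [uIcc_of_le zero_le_one]; exact hf.antitoneOn_Icc)

lemma pseudoInv_of_one_lt (hf : IsProfile K f) {y : ℝ} (hy : 1 < y) : pseudoInv f y = 0 :=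
  le_antisymm (Real.sSup_le (fun _ hx => absurd (hx.2.trans (hf.le_one hx.1.1)) hy.not_ge) le_rfl)
    (pseudoInv_nonneg f y)

lemma le_pseudoInv (hf : IsProfile K f) {y : ℝ} (hy : y ∈ Icc (0:ℝ) 1) :
    (1 - y) / K ≤ pseudoInv f y := by
  have hK : 0 < K := zero_lt_one.trans_le hf.one_le
  have hmem : (1 - y) / K ∈ Icc (0:ℝ) 1 :=
    ⟨div_nonneg (by linarith [hy.2]) hK.le, by
      rw [div_le_one hK]; linarith [hy.1, hf.one_le]⟩
  refine _root_.le_pseudoInv hmem ((le_of_eq ?_).trans (hf.lower _ hmem))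
  field_simp
  ring

lemma integral_pseudoInv (hf : IsProfile K f) :
    ∫ t in (0:ℝ)..1, pseudoInv f t = ∫ t in (0:ℝ)..1, f t := by
  have hint : Integrable f (volume.restrict (Ioc 0 1)) :=
    (intervalIntegrable_iff_integrableOn_Ioc_of_le zero_le_one).1 hf.intervalIntegrable
  rw [intervalIntegral.integral_of_le zero_le_one, intervalIntegral.integral_of_le zero_le_one,
    hint.integral_eq_integral_Ioc_meas_le (M := 1)]
  · refine setIntegral_congr_fun measurableSet_Ioc fun t _ => ?_
    have hp := pseudoInv_nonneg f t
    have hsub : Ioo 0 (pseudoInv f t) ⊆ {a | t ≤ f a} ∩ Ioc 0 1 := fun x hx =>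
      ⟨le_of_lt_pseudoInv hf.antitoneOn_Icc hx.1.le hx.2, hx.1,
        hx.2.le.trans (pseudoInv_le_one f t)⟩
    have hsup : {a | t ≤ f a} ∩ Ioc 0 1 ⊆ Icc 0 (pseudoInv f t) := fun x hx =>
      ⟨hx.2.1.le, _root_.le_pseudoInv ⟨hx.2.1.le, hx.2.2⟩ hx.1⟩
    have hvol : volume ({a | t ≤ f a} ∩ Ioc 0 1) = ENNReal.ofReal (pseudoInv f t) :=
      le_antisymm ((measure_mono hsup).trans_eq (by simp))
        ((by simp : ENNReal.ofReal (pseudoInv f t) = volume (Ioo 0 (pseudoInv f t))).trans_le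
          (measure_mono hsub))
    simp only [measureReal_def]
    rw [Measure.restrict_apply' measurableSet_Ioc, hvol, ENNReal.toReal_ofReal hp]
  · exact (ae_restrict_mem measurableSet_Ioc).mono fun x hx => hf.nonneg x hx.1.le
  · exact (ae_restrict_mem measurableSet_Ioc).mono fun x hx => hf.le_one hx.1.le

lemma integral_le_one (hf : IsProfile K f) : ∫ t in (0:ℝ)..1, f t ≤ 1 := by
  have := intervalIntegral.integral_mono_on zero_le_one hf.intervalIntegrable
    (intervalIntegrable_const (c := (1:ℝ))) fun x hx => hf.le_one hx.1
  simpa using this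

lemma integral_one_sub (x : ℝ) : ∫ t in x..(1:ℝ), (1 - t) = (1 - x) ^ 2 / 2 := by
  rw [intervalIntegral.integral_sub (by simp) (by simp)]
  simp only [intervalIntegral.integral_const, integral_id, smul_eq_mul]
  ring

lemma sq_le_integral_pseudoInv (hf : IsProfile K f) {x : ℝ} (hx : x ∈ Icc (0:ℝ) 1) :
    (1 - x) ^ 2 / 2 / K ≤ ∫ t in x..(1:ℝ), pseudoInv f t := by
  rw [← integral_one_sub, ← intervalIntegral.integral_div]
  refine intervalIntegral.integral_mono_on hx.2 (Continuous.intervalIntegrable (by fun_prop) _ _)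
    (intervalIntegrable_pseudoInv f _ _) fun t ht => hf.le_pseudoInv ⟨hx.1.trans ht.1, ht.2⟩

lemma integral_pos (hf : IsProfile K f) : 0 < ∫ t in (0:ℝ)..1, f t := by
  have hK : 0 < K := zero_lt_one.trans_le hf.one_le
  have hle := hf.sq_le_integral_pseudoInv (x := 0) ⟨le_rfl, zero_le_one⟩
  rw [hf.integral_pseudoInv] at hle
  exact lt_of_lt_of_le (by positivity) hle

end IsProfile

lemma T_sub_T (f : ℝ → ℝ) (a b : ℝ) :
    T f a - T f b = (∫ t in a..b, pseudoInv f t) / ∫ t in (0:ℝ)..1, f t := by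
  rw [T, T, ← sub_div, ← intervalIntegral.integral_add_adjacent_intervals
    (intervalIntegrable_pseudoInv f a b) (intervalIntegrable_pseudoInv f b 1), add_sub_cancel_right]

namespace IsProfile

variable {K L : ℝ} {f g : ℝ → ℝ}

lemma T_zero (hf : IsProfile K f) : T f 0 = 1 := by
  rw [T, hf.integral_pseudoInv, div_self hf.integral_pos.ne']

lemma T_of_one_le (hf : IsProfile K f) {x : ℝ} (hx : 1 ≤ x) : T f x = 0 := by
  have : ∫ t in (1:ℝ)..x, pseudoInv f t = 0 := by
    rw [intervalIntegral.integral_of_le hx]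
    exact setIntegral_eq_zero_of_forall_eq_zero fun t ht => hf.pseudoInv_of_one_lt ht.1
  rw [T, intervalIntegral.integral_symm, this]
  simp

lemma T_antitone (hf : IsProfile K f) : Antitone (T f) := fun a b hab => by
  have : 0 ≤ T f a - T f b := by
    rw [T_sub_T]
    exact div_nonneg (intervalIntegral.integral_nonneg hab fun t _ => pseudoInv_nonneg f t)
      hf.integral_pos.le
  linarith

lemma isProfile_T (hf : IsProfile K f) : IsProfile (∫ t in (0:ℝ)..1, f t)⁻¹ (T f) where
  antitone := hf.T_antitone.antitoneOn _
  nonneg x _ := by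
    rw [← hf.T_of_one_le (le_max_right x 1)]
    exact hf.T_antitone (le_max_left x 1)
  eq_zero x hx := hf.T_of_one_le hx.le
  map_zero := hf.T_zero
  one_le := (one_le_inv₀ hf.integral_pos).2 hf.integral_le_one
  lower x hx := by
    have hle : ∫ t in (0:ℝ)..x, pseudoInv f t ≤ x := by
      have := intervalIntegral.integral_mono_on hx.1 (intervalIntegrable_pseudoInv f 0 x)
        (intervalIntegrable_const (c := (1:ℝ))) fun t _ => pseudoInv_le_one f t
      simpa using this
    have hsub := T_sub_T f 0 x
    have := div_le_div_of_nonneg_right hle hf.integral_pos.le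
    rw [hf.T_zero] at hsub
    rw [mul_comm, ← div_eq_mul_inv]
    linarith

lemma sq_le_T (hf : IsProfile K f) {x : ℝ} (hx : x ∈ Icc (0:ℝ) 1) :
    (1 - x) ^ 2 / 2 / K / (∫ t in (0:ℝ)..1, f t) ≤ T f x :=
  div_le_div_of_nonneg_right (hf.sq_le_integral_pseudoInv hx) hf.integral_pos.le

lemma T_pos (hf : IsProfile K f) {x : ℝ} (hx : 0 ≤ x) (hx1 : x < 1) : 0 < T f x := by
  have hK : 0 < K := zero_lt_one.trans_le hf.one_le
  have := hf.integral_pos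
  have : 0 < 1 - x := sub_pos.2 hx1
  exact lt_of_lt_of_le (by positivity) (hf.sq_le_T ⟨hx, hx1.le⟩)

lemma lt_of_pseudoInv_lt (hf : IsProfile K f) {x y : ℝ} (hx : 0 ≤ x) (hy : 0 < y)
    (hxy : pseudoInv f y < x) : f x < y := by
  by_contra! hle
  rcases le_or_gt x 1 with hx1 | hx1
  · exact hxy.not_ge (_root_.le_pseudoInv ⟨hx, hx1⟩ hle)
  · linarith [hf.eq_zero x hx1]

/-- A point where `f* (l ·)` exceeds `c g*` yields one where `f (c ·)` exceeds `l g`. -/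
lemma exists_lt_of_pseudoInv_lt (hf : IsProfile K f) (hg : IsProfile L g) {l c z : ℝ}
    (hl : 0 < l) (hc : 0 < c) (hz : 0 < z)
    (hlt : c * pseudoInv g z < pseudoInv f (l * z)) :
    ∃ w, 0 < w ∧ pseudoInv g z < w ∧ c * w < pseudoInv f (l * z) ∧ l * g w < f (c * w) := by
  obtain ⟨w, hw, hwc⟩ := exists_between ((lt_div_iff₀' hc).2 hlt)
  rw [lt_div_iff₀' hc] at hwc
  have hwpos : 0 < w := (pseudoInv_nonneg g z).trans_lt hw
  refine ⟨w, hwpos, hw, hwc, ?_⟩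
  calc l * g w < l * z := mul_lt_mul_of_pos_left (hg.lt_of_pseudoInv_lt hwpos.le hz hw) hl
    _ ≤ f (c * w) := le_of_lt_pseudoInv hf.antitoneOn_Icc (by positivity) hwc

/-- A point where `f* (l ·)` is below `c g*` yields one where `f (c ·)` is below `l g`. -/
lemma exists_gt_of_pseudoInv_gt (hf : IsProfile K f) (hg : IsProfile L g) {l c z : ℝ}
    (hl : 0 < l) (hc : 0 < c) (hz : 0 < z)
    (hlt : pseudoInv f (l * z) < c * pseudoInv g z) :
    ∃ w, 0 < w ∧ w < pseudoInv g z ∧ pseudoInv f (l * z) < c * w ∧ f (c * w) < l * g w := by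
  obtain ⟨w, hw, hw'⟩ := exists_between ((div_lt_iff₀' hc).2 hlt)
  rw [div_lt_iff₀' hc] at hw
  have hcw : 0 < c * w := (pseudoInv_nonneg f _).trans_lt hw
  have hwpos : 0 < w := (mul_pos_iff_of_pos_left hc).1 hcw
  refine ⟨w, hwpos, hw', hw, ?_⟩
  calc f (c * w) < l * z := hf.lt_of_pseudoInv_lt hcw.le (by positivity) hw
    _ ≤ l * g w := mul_le_mul_of_nonneg_left
      (le_of_lt_pseudoInv hg.antitoneOn_Icc hwpos.le hw') hl.le

end IsProfile

lemma T_diff_eq_integral (f g : ℝ → ℝ) {l : ℝ} (hl : l ≠ 0) (c a b : ℝ) :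
    (T f (l * a) - c * T g a) - (T f (l * b) - c * T g b) =
      ∫ t in a..b, (l / (∫ s in (0:ℝ)..1, f s) * pseudoInv f (l * t) -
        c / (∫ s in (0:ℝ)..1, g s) * pseudoInv g t) := by
  have hscale : IntervalIntegrable (fun t => pseudoInv f (l * t)) volume a b := by
    rcases le_total 0 l with hl | hl
    · exact Antitone.intervalIntegrable fun x y hxy =>
        pseudoInv_antitone f (mul_le_mul_of_nonneg_left hxy hl)
    · exact Monotone.intervalIntegrable fun x y hxy =>
        pseudoInv_antitone f (mul_le_mul_of_nonpos_left hxy hl)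
  rw [intervalIntegral.integral_sub (hscale.const_mul _)
      ((intervalIntegrable_pseudoInv g a b).const_mul _),
    intervalIntegral.integral_const_mul, intervalIntegral.integral_const_mul,
    intervalIntegral.integral_comp_mul_left _ hl]
  have h1 := T_sub_T f (l * a) (l * b)
  have h2 := T_sub_T g a b
  rw [smul_eq_mul, show l / (∫ s in (0:ℝ)..1, f s) * (l⁻¹ * ∫ x in l * a..l * b, pseudoInv f x) =
      (∫ x in l * a..l * b, pseudoInv f x) / (∫ s in (0:ℝ)..1, f s) by field_simp, ← h1,
    div_mul_eq_mul_div, mul_div_assoc, ← h2]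
  ring

namespace IsProfile

variable {K L : ℝ} {f g : ℝ → ℝ}

/-- The scaling factor for which `f* (l ·) - ratio f g l c * g*` has the sign of minus the
derivative of `T f (l ·) - c * T g`. -/
def ratio (f g : ℝ → ℝ) (l c : ℝ) : ℝ :=
  c * (∫ s in (0:ℝ)..1, f s) / (l * ∫ s in (0:ℝ)..1, g s)

lemma ratio_pos (hf : IsProfile K f) (hg : IsProfile L g) {l c : ℝ} (hl : 0 < l) (hc : 0 < c) :
    0 < ratio f g l c := by
  have := hf.integral_pos
  have := hg.integral_pos
  unfold ratio
  positivity

lemma integrand_eq (hf : IsProfile K f) (hg : IsProfile L g) {l : ℝ} (hl : 0 < l) (c u v : ℝ) :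
    l / (∫ s in (0:ℝ)..1, f s) * u - c / (∫ s in (0:ℝ)..1, g s) * v =
      l / (∫ s in (0:ℝ)..1, f s) * (u - ratio f g l c * v) := by
  have := hf.integral_pos.ne'
  have := hg.integral_pos.ne'
  unfold ratio
  field_simp

lemma exists_of_T_diff_lt (hf : IsProfile K f) (hg : IsProfile L g) {l c a b : ℝ}
    (hl : 0 < l) (hc : 0 < c) (ha : 0 ≤ a) (hab : a < b)
    (hlt : T f (l * b) - c * T g b < T f (l * a) - c * T g a) :
    ∃ z w, a < z ∧ z < b ∧ 0 < w ∧ pseudoInv g z < w ∧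
      ratio f g l c * w < pseudoInv f (l * z) ∧ l * g w < f (ratio f g l c * w) := by
  by_contra! hcon
  have hint := T_diff_eq_integral f g hl.ne' c a b
  have : (∫ t in a..b, (l / (∫ s in (0:ℝ)..1, f s) * pseudoInv f (l * t) -
        c / (∫ s in (0:ℝ)..1, g s) * pseudoInv g t)) ≤ 0 := by
    rw [intervalIntegral.integral_of_le hab.le, integral_Ioc_eq_integral_Ioo]
    refine setIntegral_nonpos measurableSet_Ioo fun t ht => ?_
    rw [integrand_eq hf hg hl]
    refine mul_nonpos_of_nonneg_of_nonpos (div_nonneg hl.le hf.integral_pos.le) ?_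
    by_contra! hpos
    obtain ⟨w, h1, h2, h3, h4⟩ := hf.exists_lt_of_pseudoInv_lt hg hl (hf.ratio_pos hg hl hc)
      (ha.trans_lt ht.1) (sub_pos.1 hpos)
    exact (hcon t w ht.1 ht.2 h1 h2 h3).not_gt h4
  linarith

lemma exists_of_lt_T_diff (hf : IsProfile K f) (hg : IsProfile L g) {l c a b : ℝ}
    (hl : 0 < l) (hc : 0 < c) (ha : 0 ≤ a) (hab : a < b)
    (hlt : T f (l * a) - c * T g a < T f (l * b) - c * T g b) :
    ∃ z w, a < z ∧ z < b ∧ 0 < w ∧ w < pseudoInv g z ∧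
      pseudoInv f (l * z) < ratio f g l c * w ∧ f (ratio f g l c * w) < l * g w := by
  by_contra! hcon
  have hint := T_diff_eq_integral f g hl.ne' c a b
  have : 0 ≤ (∫ t in a..b, (l / (∫ s in (0:ℝ)..1, f s) * pseudoInv f (l * t) -
        c / (∫ s in (0:ℝ)..1, g s) * pseudoInv g t)) := by
    rw [intervalIntegral.integral_of_le hab.le, integral_Ioc_eq_integral_Ioo]
    refine setIntegral_nonneg measurableSet_Ioo fun t ht => ?_
    rw [integrand_eq hf hg hl]
    refine mul_nonneg (div_nonneg hl.le hf.integral_pos.le) ?_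
    by_contra! hneg
    obtain ⟨w, h1, h2, h3, h4⟩ := hf.exists_gt_of_pseudoInv_gt hg hl (hf.ratio_pos hg hl hc)
      (ha.trans_lt ht.1) (sub_neg.1 hneg)
    exact (hcon t w ht.1 ht.2 h1 h2 h3).not_gt h4
  linarith

lemma T_diff_eventually_zero (hf : IsProfile K f) (hg : IsProfile L g) {l : ℝ} (hl : 0 < l)
    (c z : ℝ) : ∃ b, z < b ∧ T f (l * b) - c * T g b = 0 := by
  refine ⟨max (z + 1) (max 1 l⁻¹), (lt_add_one z).trans_le (le_max_left _ _), ?_⟩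
  have h1 : 1 ≤ max (z + 1) (max 1 l⁻¹) := (le_max_left _ _).trans (le_max_right _ _)
  have h2 : 1 ≤ l * max (z + 1) (max 1 l⁻¹) := by
    rw [← div_le_iff₀' hl, one_div]
    exact (le_max_right _ _).trans (le_max_right _ _)
  rw [hf.T_of_one_le h2, hg.T_of_one_le h1]
  ring

end IsProfile

/-- Restrictions on the sign changes of `f (l ·) - c * g` on `(0, ∞)`, preserved when `T` is applied
to both functions. -/
structure Comparison (f g : ℝ → ℝ) : Prop where
  not_pos_neg_pos_neg : ∀ l c : ℝ, 0 < l → 0 < c → ∀ z₁ z₂ z₃ z₄ : ℝ,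
    0 < z₁ → z₁ < z₂ → z₂ < z₃ → z₃ < z₄ → c * g z₁ < f (l * z₁) → f (l * z₂) < c * g z₂ →
    c * g z₃ < f (l * z₃) → f (l * z₄) < c * g z₄ → False
  not_neg_pos_neg_pos : ∀ l c : ℝ, 0 < l → 0 < c → ∀ z₁ z₂ z₃ z₄ : ℝ,
    0 < z₁ → z₁ < z₂ → z₂ < z₃ → z₃ < z₄ → f (l * z₁) < c * g z₁ → c * g z₂ < f (l * z₂) →
    f (l * z₃) < c * g z₃ → c * g z₄ < f (l * z₄) → False
  not_pos_neg_pos : ∀ l : ℝ, 0 < l → ∀ z₁ z₂ z₃ : ℝ,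
    0 < z₁ → z₁ < z₂ → z₂ < z₃ → g z₁ < f (l * z₁) → f (l * z₂) < g z₂ →
    g z₃ < f (l * z₃) → False
  le : ∀ x, 0 ≤ x → f x ≤ g x

namespace Comparison

variable {K L : ℝ} {f g : ℝ → ℝ}

lemma lt_of_pos_neg {z z' w w' : ℝ} (hz : z < z') (hw : pseudoInv g z < w)
    (hw' : w' < pseudoInv g z') : w' < w :=
  (hw'.trans_le (pseudoInv_antitone g hz.le)).trans hw

lemma lt_of_neg_pos {l r z z' w w' : ℝ} (hl : 0 < l) (hr : 0 < r) (hz : z < z')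
    (hw : pseudoInv f (l * z) < r * w) (hw' : r * w' < pseudoInv f (l * z')) : w' < w := by
  have := pseudoInv_antitone f (mul_le_mul_of_nonneg_left hz.le hl.le)
  exact lt_of_mul_lt_mul_left (hw'.trans_le (this.trans hw.le)) hr.le

lemma integral_le (hf : IsProfile K f) (hg : IsProfile L g) (H : Comparison f g) :
    ∫ t in (0:ℝ)..1, f t ≤ ∫ t in (0:ℝ)..1, g t :=
  intervalIntegral.integral_mono_on zero_le_one hf.intervalIntegrable hg.intervalIntegrable
    fun x hx => H.le x hx.1

lemma T_le_T (hf : IsProfile K f) (hg : IsProfile L g) (H : Comparison f g)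
    (hpos : ∀ x, 0 ≤ x → x < 1 → 0 < f x) {x : ℝ} (hx : 0 ≤ x) : T f x ≤ T g x := by
  by_contra! hlt
  have hx0 : 0 < x := hx.lt_of_ne fun h0 => by
    rw [← h0, hf.T_zero, hg.T_zero] at hlt
    exact lt_irrefl _ hlt
  obtain ⟨b, hxb, hb⟩ := hf.T_diff_eventually_zero hg one_pos 1 x
  obtain ⟨z₁, w₁, -, hz₁, hw₁, hg₁, hf₁, hneg⟩ := hf.exists_of_lt_T_diff hg one_pos one_pos le_rfl
    hx0 (by simp only [mul_zero, one_mul, hf.T_zero, hg.T_zero]; linarith)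
  obtain ⟨z₂, w₂, hz₂, -, hw₂, hg₂, hf₂, hpos'⟩ := hf.exists_of_T_diff_lt hg one_pos one_pos hx hxb
    (by rw [hb, one_mul, one_mul]; linarith)
  have hr := hf.ratio_pos hg one_pos one_pos
  have hr1 : IsProfile.ratio f g 1 1 ≤ 1 := by
    rw [IsProfile.ratio, one_mul, one_mul, div_le_one hg.integral_pos]
    exact H.integral_le hf hg
  have hw := lt_of_neg_pos one_pos hr (hz₁.trans hz₂) hf₁ hf₂
  generalize IsProfile.ratio f g 1 1 = r at *
  rw [one_mul] at hneg hpos'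
  rcases hr1.eq_or_lt with rfl | hr1
  · rw [one_mul] at hpos'
    exact hpos'.not_ge (H.le w₂ hw₂.le)
  · have hw1 := hg₁.trans_le (pseudoInv_le_one g z₁)
    obtain ⟨w₃, hw₃, hw₃'⟩ := exists_between ((one_lt_inv₀ hr).2 hr1)
    have hrw : r * w₃ < 1 := by rwa [← lt_inv_mul_iff₀ hr, mul_one]
    refine H.not_pos_neg_pos r hr w₂ w₁ w₃ hw₂ hw (hw1.trans hw₃) hpos' hneg ?_
    rw [hg.eq_zero w₃ hw₃]
    exact hpos _ (by nlinarith) hrw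

lemma T_T (hf : IsProfile K f) (hg : IsProfile L g) (H : Comparison f g)
    (hpos : ∀ x, 0 ≤ x → x < 1 → 0 < f x) : Comparison (T f) (T g) where
  not_pos_neg_pos_neg l c hl hc x₁ x₂ x₃ x₄ h0 h12 h23 h34 s₁ s₂ s₃ s₄ := by
    obtain ⟨b, h4b, hb⟩ := hf.T_diff_eventually_zero hg hl c x₄
    obtain ⟨z₁, w₁, -, a₁, p₁, g₁, f₁, e₁⟩ := hf.exists_of_T_diff_lt hg hl hc h0.le h12
      (by linarith)
    obtain ⟨z₂, w₂, b₂, a₂, p₂, g₂, f₂, e₂⟩ := hf.exists_of_lt_T_diff hg hl hc (by linarith) h23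
      (by linarith)
    obtain ⟨z₃, w₃, b₃, a₃, p₃, g₃, f₃, e₃⟩ := hf.exists_of_T_diff_lt hg hl hc (by linarith) h34
      (by linarith)
    obtain ⟨z₄, w₄, b₄, -, p₄, g₄, f₄, e₄⟩ := hf.exists_of_lt_T_diff hg hl hc (by linarith) h4b
      (by linarith)
    have hr := hf.ratio_pos hg hl hc
    exact H.not_neg_pos_neg_pos _ l hr hl w₄ w₃ w₂ w₁ p₄ (lt_of_pos_neg (a₃.trans b₄) g₃ g₄)
      (lt_of_neg_pos hl hr (a₂.trans b₃) f₂ f₃) (lt_of_pos_neg (a₁.trans b₂) g₁ g₂) e₄ e₃ e₂ e₁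
  not_neg_pos_neg_pos l c hl hc x₁ x₂ x₃ x₄ h0 h12 h23 h34 s₁ s₂ s₃ s₄ := by
    obtain ⟨b, h4b, hb⟩ := hf.T_diff_eventually_zero hg hl c x₄
    obtain ⟨z₁, w₁, -, a₁, p₁, g₁, f₁, e₁⟩ := hf.exists_of_lt_T_diff hg hl hc h0.le h12
      (by linarith)
    obtain ⟨z₂, w₂, b₂, a₂, p₂, g₂, f₂, e₂⟩ := hf.exists_of_T_diff_lt hg hl hc (by linarith) h23
      (by linarith)
    obtain ⟨z₃, w₃, b₃, a₃, p₃, g₃, f₃, e₃⟩ := hf.exists_of_lt_T_diff hg hl hc (by linarith) h34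
      (by linarith)
    obtain ⟨z₄, w₄, b₄, -, p₄, g₄, f₄, e₄⟩ := hf.exists_of_T_diff_lt hg hl hc (by linarith) h4b
      (by linarith)
    have hr := hf.ratio_pos hg hl hc
    exact H.not_pos_neg_pos_neg _ l hr hl w₄ w₃ w₂ w₁ p₄ (lt_of_neg_pos hl hr (a₃.trans b₄) f₃ f₄)
      (lt_of_pos_neg (a₂.trans b₃) g₂ g₃) (lt_of_neg_pos hl hr (a₁.trans b₂) f₁ f₂) e₄ e₃ e₂ e₁
  not_pos_neg_pos l hl x₁ x₂ x₃ h0 h12 h23 s₁ s₂ s₃ := by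
    obtain ⟨b, h3b, hb⟩ := hf.T_diff_eventually_zero hg hl 1 x₃
    obtain ⟨z₁, w₁, -, a₁, p₁, g₁, f₁, e₁⟩ := hf.exists_of_lt_T_diff hg hl one_pos le_rfl h0
      (by rw [mul_zero, hf.T_zero, hg.T_zero]; linarith)
    obtain ⟨z₂, w₂, b₂, a₂, p₂, g₂, f₂, e₂⟩ := hf.exists_of_T_diff_lt hg hl one_pos h0.le h12
      (by linarith)
    obtain ⟨z₃, w₃, b₃, a₃, p₃, g₃, f₃, e₃⟩ := hf.exists_of_lt_T_diff hg hl one_pos (by linarith)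
      h23 (by linarith)
    obtain ⟨z₄, w₄, b₄, -, p₄, g₄, f₄, e₄⟩ := hf.exists_of_T_diff_lt hg hl one_pos (by linarith)
      h3b (by linarith)
    have hr := hf.ratio_pos hg hl one_pos
    exact H.not_pos_neg_pos_neg _ l hr hl w₄ w₃ w₂ w₁ p₄ (lt_of_neg_pos hl hr (a₃.trans b₄) f₃ f₄)
      (lt_of_pos_neg (a₂.trans b₃) g₂ g₃) (lt_of_neg_pos hl hr (a₁.trans b₂) f₁ f₂) e₄ e₃ e₂ e₁
  le _ hx := H.T_le_T hf hg hpos hx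

end Comparison

/-- The canonical iterates, with the initial function cut off beyond `1`. -/
def cutIter : ℕ → ℝ → ℝ
  | 0 => fun x => if x ≤ 1 then 1 else 0
  | n + 1 => T (cutIter n)

lemma cutIter_succ_eq (n : ℕ) : cutIter (n + 1) = h (n + 1) := by
  induction n with
  | zero => exact T_congr fun x hx => by simp [cutIter, h, hx.2]
  | succ n ih => exact congrArg T ih

lemma cutIter_eq (n : ℕ) {x : ℝ} (hx : x ∈ Icc (0:ℝ) 1) : cutIter n x = h n x := by
  cases n with
  | zero => simp [cutIter, h, hx.2]
  | succ n => rw [cutIter_succ_eq]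

lemma cutIter_zero_of_le {x : ℝ} (hx : x ≤ 1) : cutIter 0 x = 1 := if_pos hx

lemma isProfile_cutIter_zero : IsProfile 1 (cutIter 0) where
  antitone x _ y _ hxy := by
    simp only [cutIter]
    split_ifs <;> linarith
  nonneg x _ := by
    simp only [cutIter]
    split_ifs <;> norm_num
  eq_zero x hx := if_neg hx.not_ge
  map_zero := if_pos zero_le_one
  one_le := le_rfl
  lower x hx := by
    simp only [cutIter, if_pos hx.2]
    linarith [hx.1]

lemma exists_isProfile_cutIter (n : ℕ) : ∃ K, IsProfile K (cutIter n) := by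
  induction n with
  | zero => exact ⟨1, isProfile_cutIter_zero⟩
  | succ n ih =>
    obtain ⟨K, hK⟩ := ih
    exact ⟨_, hK.isProfile_T⟩

lemma comparison_cutIter_zero : Comparison (cutIter 1) (cutIter 0) := by
  have hf : IsProfile _ (cutIter 1) := isProfile_cutIter_zero.isProfile_T
  have hanti : ∀ l c z z' : ℝ, 0 < l → 0 < c → 0 < z → z < z' → z' ≤ 1 →
      cutIter 1 (l * z) < c * cutIter 0 z → c * cutIter 0 z' < cutIter 1 (l * z') → False := by
    intro l c z z' hl hc hz hzz hz1 s s'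
    have := isProfile_cutIter_zero.T_antitone (mul_le_mul_of_nonneg_left hzz.le hl.le)
    rw [cutIter_zero_of_le (hzz.le.trans hz1)] at s
    rw [cutIter_zero_of_le hz1] at s'
    exact (s.trans s').not_ge this
  have hone : ∀ l c z : ℝ, 0 < l → 0 < z → cutIter 1 (l * z) < c * cutIter 0 z → z ≤ 1 := by
    intro l c z hl hz s
    by_contra! hz1
    rw [isProfile_cutIter_zero.eq_zero z hz1, mul_zero] at s
    exact s.not_ge (hf.nonneg _ (by positivity))
  refine ⟨?_, ?_, ?_, ?_⟩
  · intro l c hl hc z₁ z₂ z₃ z₄ h0 h12 h23 h34 _ s₂ s₃ s₄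
    have := hone l c z₄ hl (by linarith) s₄
    exact hanti l c z₂ z₃ hl hc (by linarith) h23 (by linarith) s₂ s₃
  · intro l c hl hc z₁ z₂ z₃ z₄ h0 h12 h23 h34 s₁ s₂ s₃ _
    have := hone l c z₃ hl (by linarith) s₃
    exact hanti l c z₁ z₂ hl hc (by linarith) h12 (by linarith) s₁ s₂
  · intro l hl z₁ z₂ z₃ h0 h12 h23 s₁ s₂ _
    have := hone l 1 z₂ hl (by linarith) (by rwa [one_mul])
    rw [cutIter_zero_of_le (by linarith)] at s₁
    exact s₁.not_ge (hf.le_one (by positivity))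
  · intro x hx
    rcases le_or_gt x 1 with hx1 | hx1
    · exact (hf.le_one hx).trans_eq (if_pos hx1).symm
    · rw [hf.eq_zero x hx1, isProfile_cutIter_zero.eq_zero x hx1]

lemma comparison_cutIter (n : ℕ) : Comparison (cutIter (n + 1)) (cutIter n) := by
  induction n with
  | zero => exact comparison_cutIter_zero
  | succ n ih =>
    obtain ⟨K, hK⟩ := exists_isProfile_cutIter n
    exact ih.T_T hK.isProfile_T hK fun x hx hx1 => hK.T_pos hx hx1

lemma IsProfile.half_sq_le_T {K : ℝ} {f : ℝ → ℝ} (hf : IsProfile K f)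
    (hK : K * ∫ t in (0:ℝ)..1, f t ≤ 1) {x : ℝ} (hx : x ∈ Icc (0:ℝ) 1) :
    (1 - x) ^ 2 / 2 ≤ T f x := by
  refine le_trans ?_ (hf.sq_le_T hx)
  have hKpos : 0 < K := zero_lt_one.trans_le hf.one_le
  rw [div_div _ K, le_div_iff₀ (mul_pos hKpos hf.integral_pos)]
  exact mul_le_of_le_one_right (by positivity) hK

lemma half_sq_le_h (n : ℕ) {x : ℝ} (hx : x ∈ Icc (0:ℝ) 1) : (1 - x) ^ 2 / 2 ≤ h n x := by
  rw [← cutIter_eq n hx]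
  match n with
  | 0 =>
    rw [cutIter_zero_of_le hx.2]
    nlinarith [hx.1, hx.2]
  | 1 =>
    exact isProfile_cutIter_zero.half_sq_le_T (by simpa using isProfile_cutIter_zero.integral_le_one)
      hx
  | n + 2 =>
    obtain ⟨K, hK⟩ := exists_isProfile_cutIter n
    refine hK.isProfile_T.half_sq_le_T ?_ hx
    rw [inv_mul_le_one₀ hK.integral_pos]
    exact (comparison_cutIter n).integral_le hK.isProfile_T hK

lemma h_antitone_index {x : ℝ} (hx : x ∈ Icc (0:ℝ) 1) : Antitone fun n => h n x :=
  antitone_nat_of_succ_le fun n => by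
    rw [← cutIter_eq n hx, ← cutIter_eq (n + 1) hx]
    exact (comparison_cutIter n).le x hx.1

lemma h_antitoneOn (n : ℕ) : AntitoneOn (h n) (Icc 0 1) := by
  obtain ⟨K, hK⟩ := exists_isProfile_cutIter n
  exact hK.antitoneOn_Icc.congr fun x hx => cutIter_eq n hx

lemma h_mem_Icc (n : ℕ) {x : ℝ} (hx : x ∈ Icc (0:ℝ) 1) : h n x ∈ Icc (0:ℝ) 1 := by
  obtain ⟨K, hK⟩ := exists_isProfile_cutIter n
  rw [← cutIter_eq n hx]
  exact ⟨hK.nonneg x hx.1, hK.le_one hx.1⟩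

lemma h_zero_right (n : ℕ) : h n 0 = 1 := by
  obtain ⟨K, hK⟩ := exists_isProfile_cutIter n
  rw [← cutIter_eq n ⟨le_rfl, zero_le_one⟩, hK.map_zero]

lemma bddBelow_h {x : ℝ} (hx : x ∈ Icc (0:ℝ) 1) : BddBelow (range fun n => h n x) :=
  ⟨0, by rintro _ ⟨n, rfl⟩; exact (h_mem_Icc n hx).1⟩

lemma tendsto_h {x : ℝ} (hx : x ∈ Icc (0:ℝ) 1) :
    Filter.Tendsto (fun n => h n x) Filter.atTop (nhds (⨅ n, h n x)) :=
  tendsto_atTop_ciInf (h_antitone_index hx) (bddBelow_h hx)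

lemma pseudoInv_iInf_h (y : ℝ) :
    pseudoInv (fun x => ⨅ n, h n x) y = ⨅ n, pseudoInv (h n) y := by
  refine le_antisymm (le_ciInf fun n => pseudoInv_mono (fun x hx => ciInf_le (bddBelow_h hx) n) y) ?_
  by_contra! hlt
  obtain ⟨x, hx, hx'⟩ := exists_between hlt
  have hbdd : BddBelow (range fun n => pseudoInv (h n) y) :=
    ⟨0, by rintro _ ⟨n, rfl⟩; exact pseudoInv_nonneg _ _⟩
  have hx0 : 0 ≤ x := (pseudoInv_nonneg _ _).trans hx.le
  have hxn : ∀ n, x < pseudoInv (h n) y := fun n => hx'.trans_le (ciInf_le hbdd n)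
  have hx1 : x ≤ 1 := (hxn 0).le.trans (pseudoInv_le_one _ _)
  exact hx.not_ge (le_pseudoInv ⟨hx0, hx1⟩
    (le_ciInf fun n => le_of_lt_pseudoInv (h_antitoneOn n) hx0 (hxn n)))

lemma tendsto_pseudoInv_h (y : ℝ) :
    Filter.Tendsto (fun n => pseudoInv (h n) y) Filter.atTop
      (nhds (pseudoInv (fun x => ⨅ n, h n x) y)) := by
  rw [pseudoInv_iInf_h]
  refine tendsto_atTop_ciInf (antitone_nat_of_succ_le fun n => pseudoInv_mono (fun x hx =>
    h_antitone_index hx n.le_succ) y) ⟨0, ?_⟩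
  rintro _ ⟨n, rfl⟩
  exact pseudoInv_nonneg _ _

lemma h_intervalIntegrable (n : ℕ) : IntervalIntegrable (h n) volume 0 1 :=
  AntitoneOn.intervalIntegrable (by rw [uIcc_of_le zero_le_one]; exact h_antitoneOn n)

lemma tendsto_integral_h :
    Filter.Tendsto (fun n => ∫ t in (0:ℝ)..1, h n t) Filter.atTop
      (nhds (∫ t in (0:ℝ)..1, ⨅ n, h n t)) := by
  have hmem : ∀ t ∈ uIoc (0:ℝ) 1, t ∈ Icc (0:ℝ) 1 := fun t ht => by
    rw [uIoc_of_le zero_le_one] at ht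
    exact Ioc_subset_Icc_self ht
  refine intervalIntegral.tendsto_integral_filter_of_dominated_convergence (fun _ => 1)
    (.of_forall fun n => (h_intervalIntegrable n).aestronglyMeasurable_restrict_uIoc)
    (.of_forall fun n => .of_forall fun t ht => ?_) intervalIntegrable_const
    (.of_forall fun t ht => tendsto_h (hmem t ht))
  rw [Real.norm_of_nonneg (h_mem_Icc n (hmem t ht)).1]
  exact (h_mem_Icc n (hmem t ht)).2

lemma tendsto_integral_pseudoInv_h (x : ℝ) :
    Filter.Tendsto (fun n => ∫ t in x..(1:ℝ), pseudoInv (h n) t) Filter.atTop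
      (nhds (∫ t in x..(1:ℝ), pseudoInv (fun x => ⨅ n, h n x) t)) := by
  refine intervalIntegral.tendsto_integral_filter_of_dominated_convergence (fun _ => 1)
    (.of_forall fun n => (intervalIntegrable_pseudoInv _ x 1).aestronglyMeasurable_restrict_uIoc)
    (.of_forall fun n => .of_forall fun t _ => ?_) intervalIntegrable_const
    (.of_forall fun t _ => tendsto_pseudoInv_h t)
  rw [Real.norm_of_nonneg (pseudoInv_nonneg _ _)]
  exact pseudoInv_le_one _ _

lemma iInf_h_antitoneOn : AntitoneOn (fun x => ⨅ n, h n x) (Icc 0 1) := fun _ hx _ hy hxy =>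
  ciInf_mono (bddBelow_h hy) fun n => h_antitoneOn n hx hy hxy

lemma integral_iInf_h_pos : 0 < ∫ x in (0:ℝ)..1, ⨅ n, h n x := by
  have hle : ∫ x in (0:ℝ)..1, (1 - x) ^ 2 / 2 ≤ ∫ x in (0:ℝ)..1, ⨅ n, h n x :=
    intervalIntegral.integral_mono_on zero_le_one (Continuous.intervalIntegrable (by fun_prop) _ _)
      (AntitoneOn.intervalIntegrable (by rw [uIcc_of_le zero_le_one]; exact iInf_h_antitoneOn))
      fun x hx => le_ciInf fun n => half_sq_le_h n hx
  refine lt_of_lt_of_le ?_ hle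
  refine intervalIntegral.intervalIntegral_pos_of_pos_on
    (Continuous.intervalIntegrable (by fun_prop) _ _) (fun x hx => ?_) zero_lt_one
  have : 0 < 1 - x := sub_pos.2 hx.2
  positivity

/-- The pointwise limit h = inf_n (h n) belongs to E and is a fixed point of T. -/
theorem stmt13 :
    (fun x => ⨅ n : ℕ, h n x) ∈ E ∧
    ∀ x ∈ Icc (0:ℝ) 1, T (fun x => ⨅ n : ℕ, h n x) x = ⨅ n : ℕ, h n x := by
  refine ⟨⟨iInf_h_antitoneOn, fun x hx => ⟨le_ciInf fun n => (h_mem_Icc n hx).1,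
    (ciInf_le (bddBelow_h hx) 0).trans (h_mem_Icc 0 hx).2⟩, ?_, integral_iInf_h_pos⟩, fun x hx => ?_⟩
  · simp only [h_zero_right, ciInf_const]
  · exact tendsto_nhds_unique
      ((tendsto_integral_pseudoInv_h x).div tendsto_integral_h integral_iInf_h_pos.ne')
      ((tendsto_h hx).comp (Filter.tendsto_add_atTop_nat 1))
end
end

section
/- The first values of κ_n := ∫₀¹ h_n are κ₀ = 1, κ₁ = 1/2, κ₂ = 1/3, κ₃ = 3/10, and κ₄ = 2/7. -/
open Set MeasureTheory Polynomial

noncomputable section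

/-- If the graph of `g` over `[0,1]` is parametrised by `w ↦ (a w, b w)`, with `a` increasing from
`0` to `1` and `b` strictly decreasing, then `pseudoInv g` maps `b w` to `a w`. -/
theorem pseudoInv_param {g a b : ℝ → ℝ} (hg : ∀ w ∈ Icc (0:ℝ) 1, g (a w) = b w)
    (ha : MonotoneOn a (Icc 0 1)) (hac : ContinuousOn a (Icc 0 1)) (ha0 : a 0 = 0) (ha1 : a 1 = 1)
    (hb : StrictAntiOn b (Icc 0 1)) {w : ℝ} (hw : w ∈ Icc (0:ℝ) 1) :
    pseudoInv g (b w) = a w := by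
  have haw : a w ∈ Icc (0:ℝ) 1 := by
    have h0 := ha (left_mem_Icc.2 zero_le_one) hw hw.1
    have h1 := ha hw (right_mem_Icc.2 zero_le_one) hw.2
    exact ⟨ha0 ▸ h0, ha1 ▸ h1⟩
  refine IsGreatest.csSup_eq ⟨⟨haw, (hg w hw).ge⟩, ?_⟩
  rintro x ⟨hx, hle⟩
  obtain ⟨v, hv, rfl⟩ : x ∈ a '' Icc 0 1 :=
    intermediate_value_Icc zero_le_one hac (by rwa [ha0, ha1])
  rw [hg v hv] at hle
  exact ha hv hw ((hb.le_iff_ge hw hv).1 hle)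

/-- Integral of a function whose graph is parametrised by `w ↦ (a w, b w)`. -/
theorem integral_param {g a a' b : ℝ → ℝ} (hg : ∀ w ∈ Icc (0:ℝ) 1, g (a w) = b w)
    (ha : ∀ w, HasDerivAt a (a' w) w) (ha' : ∀ w ∈ Ioo (0:ℝ) 1, 0 ≤ a' w)
    (ha0 : a 0 = 0) (ha1 : a 1 = 1) :
    ∫ x in (0:ℝ)..1, g x = ∫ w in (0:ℝ)..1, b w * a' w := by
  have hac : Continuous a := continuous_iff_continuousAt.2 fun w => (ha w).continuousAt
  have key := intervalIntegral.integral_comp_mul_deriv_of_deriv_nonneg (a := 0) (b := 1)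
    (f := a) (f' := a') (g := g) hac.continuousOn (fun w _ => ha w) (by simpa using ha')
  rw [ha0, ha1] at key
  rw [← key]
  refine intervalIntegral.integral_congr fun w hw => ?_
  rw [uIcc_of_le zero_le_one] at hw
  simp only [Function.comp_apply, hg w hw]

/-- Parametrisation of `T g` in terms of one of `g`. -/
theorem T_param {g a a' b b' : ℝ → ℝ} (hg : ∀ w ∈ Icc (0:ℝ) 1, g (a w) = b w)
    (ha : ∀ w, HasDerivAt a (a' w) w) (ha' : ∀ w ∈ Ioo (0:ℝ) 1, 0 ≤ a' w)
    (ha0 : a 0 = 0) (ha1 : a 1 = 1)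
    (hb : ∀ w, HasDerivAt b (b' w) w) (hb' : ∀ w ∈ Ioo (0:ℝ) 1, b' w < 0) (hb0 : b 0 = 1)
    {w : ℝ} (hw : w ∈ Icc (0:ℝ) 1) :
    T g (b w) = (-∫ v in (0:ℝ)..w, a v * b' v) / ∫ x in (0:ℝ)..1, g x := by
  have hac : Continuous a := continuous_iff_continuousAt.2 fun w => (ha w).continuousAt
  have hbc : Continuous b := continuous_iff_continuousAt.2 fun w => (hb w).continuousAt
  have hmono : MonotoneOn a (Icc 0 1) :=
    monotoneOn_of_deriv_nonneg (convex_Icc 0 1) hac.continuousOn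
      (fun w _ => (ha w).differentiableAt.differentiableWithinAt)
      (by simpa [interior_Icc, (ha _).deriv] using ha')
  have hanti : StrictAntiOn b (Icc 0 1) :=
    strictAntiOn_of_deriv_neg (convex_Icc 0 1) hbc.continuousOn
      (by simpa [interior_Icc, (hb _).deriv] using hb')
  have key := intervalIntegral.integral_comp_mul_deriv_of_deriv_nonpos (a := 0) (b := w)
    (f := b) (f' := b') (g := pseudoInv g) hbc.continuousOn (fun w _ => hb w)
    (by
      rw [min_eq_left hw.1, max_eq_right hw.1]
      exact fun v hv => (hb' v ⟨hv.1, hv.2.trans_le hw.2⟩).le)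
  rw [hb0] at key
  rw [T, intervalIntegral.integral_symm, ← key]
  congr 2
  refine intervalIntegral.integral_congr fun v hv => ?_
  rw [uIcc_of_le hw.1] at hv
  simp only [Function.comp_apply,
    pseudoInv_param hg hmono hac.continuousOn ha0 ha1 hanti ⟨hv.1, hv.2.trans hw.2⟩]

theorem h_one {x : ℝ} (hx : x ∈ Icc (0:ℝ) 1) : h 1 x = 1 - x := by
  have key : ∀ t ∈ uIcc x 1, pseudoInv (h 0) t = 1 := by
    intro t ht
    rw [uIcc_of_le hx.2] at ht
    exact IsGreatest.csSup_eq ⟨⟨right_mem_Icc.2 zero_le_one, ht.2⟩, fun y hy => hy.1.2⟩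
  rw [h, T, intervalIntegral.integral_congr (g := fun _ => 1) key]
  simp [h]

theorem κ_one : κ 1 = 1 / 2 := by
  rw [κ, integral_param (a := fun w => w) (a' := fun _ => 1) (b := fun w => 1 - w)
    (fun w hw => h_one hw) (fun w => hasDerivAt_id w) (fun _ _ => zero_le_one) rfl rfl]
  rw [intervalIntegral.integral_eq_sub_of_hasDerivAt (f := fun w : ℝ => w - w ^ 2 / 2)]
  · norm_num
  · intro w _
    convert! (hasDerivAt_id w).sub ((hasDerivAt_pow 2 w).div_const 2) using 1
    norm_num
  · exact Continuous.intervalIntegrable (by fun_prop) _ _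

theorem one_sub_mem_unit {w : ℝ} (hw : w ∈ Icc (0:ℝ) 1) : 1 - w ∈ Icc (0:ℝ) 1 :=
  ⟨by linarith [hw.2], by linarith [hw.1]⟩

theorem h_two {w : ℝ} (hw : w ∈ Icc (0:ℝ) 1) : h 2 w = (1 - w) ^ 2 := by
  have key := T_param (g := h 1) (a := fun w => w) (a' := fun _ => 1) (b := fun w => 1 - w)
    (b' := fun _ => -1) (fun w hw => h_one hw) (fun w => hasDerivAt_id w)
    (fun _ _ => zero_le_one) rfl rfl (fun w => by simpa using (hasDerivAt_id w).const_sub 1)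
    (fun _ _ => by norm_num) (by norm_num) (one_sub_mem_unit hw)
  change h 2 _ = _ / κ 1 at key
  rw [κ_one, intervalIntegral.integral_eq_sub_of_hasDerivAt
    (f := fun w : ℝ => -(w ^ 2 / 2))] at key
  · simp only [sub_sub_cancel] at key
    rw [key]
    ring
  · intro w _
    convert! ((hasDerivAt_pow 2 w).div_const 2).neg using 1
    norm_num
  · exact Continuous.intervalIntegrable (by fun_prop) _ _

theorem κ_two : κ 2 = 1 / 3 := by
  rw [κ, integral_param (a := fun w => w) (a' := fun _ => 1) (b := fun w => (1 - w) ^ 2)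
    (fun w hw => h_two hw) (fun w => hasDerivAt_id w) (fun _ _ => zero_le_one) rfl rfl]
  rw [intervalIntegral.integral_eq_sub_of_hasDerivAt (f := fun w : ℝ => -(1 - w) ^ 3 / 3)]
  · norm_num
  · intro w _
    convert! ((((hasDerivAt_id w).const_sub 1).pow 3).neg.div_const 3) using 1
    simp
  · exact Continuous.intervalIntegrable (by fun_prop) _ _

theorem h_three {w : ℝ} (hw : w ∈ Icc (0:ℝ) 1) : h 3 (w ^ 2) = 1 - 3 * w ^ 2 + 2 * w ^ 3 := by
  have key := T_param (g := h 2) (a := fun w => w) (a' := fun _ => 1) (b := fun w => (1 - w) ^ 2)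
    (b' := fun w => -(2 * (1 - w))) (fun w hw => h_two hw) (fun w => hasDerivAt_id w)
    (fun _ _ => zero_le_one) rfl rfl
    (fun w => by
      convert! ((hasDerivAt_id w).const_sub 1).pow 2 using 1
      simp)
    (fun w hw => by linarith [hw.2]) (by norm_num) (one_sub_mem_unit hw)
  change h 3 _ = _ / κ 2 at key
  rw [κ_two, intervalIntegral.integral_eq_sub_of_hasDerivAt
    (f := fun w : ℝ => -w ^ 2 + 2 / 3 * w ^ 3)] at key
  · simp only [sub_sub_cancel] at key
    rw [key]
    ring
  · intro w _
    convert! ((hasDerivAt_pow 2 w).neg.add ((hasDerivAt_pow 3 w).const_mul (2 / 3))) using 1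
    norm_num
    ring
  · exact Continuous.intervalIntegrable (by fun_prop) _ _

theorem κ_three : κ 3 = 3 / 10 := by
  rw [κ, integral_param (a := fun w => w ^ 2) (a' := fun w => 2 * w)
    (b := fun w => 1 - 3 * w ^ 2 + 2 * w ^ 3) (fun w hw => h_three hw)
    (fun w => by simpa using hasDerivAt_pow 2 w) (fun w hw => by linarith [hw.1])
    (by norm_num) (by norm_num)]
  rw [intervalIntegral.integral_eq_sub_of_hasDerivAt
    (f := fun w : ℝ => w ^ 2 - 3 / 2 * w ^ 4 + 4 / 5 * w ^ 5)]
  · norm_num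
  · intro w _
    convert! (((hasDerivAt_pow 2 w).sub ((hasDerivAt_pow 4 w).const_mul (3 / 2))).add
      ((hasDerivAt_pow 5 w).const_mul (4 / 5))) using 1
    norm_num
    ring
  · exact Continuous.intervalIntegrable (by fun_prop) _ _

theorem h_four {w : ℝ} (hw : w ∈ Icc (0:ℝ) 1) :
    h 4 (3 * w ^ 2 - 2 * w ^ 3) = 5 * (1 - w) ^ 4 - 4 * (1 - w) ^ 5 := by
  have key := T_param (g := h 3) (a := fun w => w ^ 2) (a' := fun w => 2 * w)
    (b := fun w => 1 - 3 * w ^ 2 + 2 * w ^ 3) (b' := fun w => -(6 * (w * (1 - w))))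
    (fun w hw => h_three hw)
    (fun w => by simpa using hasDerivAt_pow 2 w) (fun w hw => by linarith [hw.1])
    (by norm_num) (by norm_num)
    (fun w => by
      convert! (((hasDerivAt_pow 2 w).const_mul 3).const_sub 1).add
        ((hasDerivAt_pow 3 w).const_mul 2) using 1
      norm_num
      ring)
    (fun w hw => by linarith [mul_pos hw.1 (sub_pos.2 hw.2)]) (by norm_num) (one_sub_mem_unit hw)
  change h 4 _ = _ / κ 3 at key
  rw [κ_three, intervalIntegral.integral_eq_sub_of_hasDerivAt
    (f := fun w : ℝ => -(3 / 2) * w ^ 4 + 6 / 5 * w ^ 5)] at key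
  · convert! key using 1
    · congr 1
      ring
    · ring
  · intro w _
    convert! (((hasDerivAt_pow 4 w).const_mul (-(3 / 2))).add
      ((hasDerivAt_pow 5 w).const_mul (6 / 5))) using 1
    norm_num
    ring
  · exact Continuous.intervalIntegrable (by fun_prop) _ _

theorem κ_four : κ 4 = 2 / 7 := by
  rw [κ, integral_param (a := fun w => 3 * w ^ 2 - 2 * w ^ 3) (a' := fun w => 6 * (w * (1 - w)))
    (b := fun w => 5 * (1 - w) ^ 4 - 4 * (1 - w) ^ 5) (fun w hw => h_four hw)
    (fun w => by
      convert! ((hasDerivAt_pow 2 w).const_mul 3).sub ((hasDerivAt_pow 3 w).const_mul 2) using 1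
      norm_num
      ring)
    (fun w hw => by linarith [mul_pos hw.1 (sub_pos.2 hw.2)]) (by norm_num) (by norm_num)]
  rw [intervalIntegral.integral_eq_sub_of_hasDerivAt
    (f := fun w : ℝ => -5 * (1 - w) ^ 6 + 54 / 7 * (1 - w) ^ 7 - 3 * (1 - w) ^ 8)]
  · norm_num
  · intro w _
    have hd := (hasDerivAt_id w).const_sub 1
    convert! (((hd.pow 6).const_mul (-5)).add ((hd.pow 7).const_mul (54 / 7))).sub
      ((hd.pow 8).const_mul 3) using 1
    norm_num
    ring
  · exact Continuous.intervalIntegrable (by fun_prop) _ _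

/-- The first values of κ. -/
theorem stmt18 : κ 0 = 1 ∧ κ 1 = 1 / 2 ∧ κ 2 = 1 / 3 ∧ κ 3 = 3 / 10 ∧
    κ 4 = 2 / 7 :=
  ⟨by simp [κ, h], κ_one, κ_two, κ_three, κ_four⟩
end
end
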